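/- arXiv:2209.10936 — 8 statements merged into one kernel-verified Lean document; each statement's English description precedes it below -/
import Mathlib

section
/- Let X_P be a standard Pareto random variable, B an independent random variable uniform on {0,1}, Y = B + (1-B)(2 - 1/X_P), and let X_L = F_L^{-1}(1 - 1/X_P) and Y_L = F_L^{-1}(F_Y(Y)) be the Laplace-scale transforms, where F_Y is the cumulative distribution function of Y. Then almost surely: on the event {B = 0, X_L > 0} one has Y_L = log 2 + X_L, and on the event {B = 1} one has Y_L = 0. -/
open MeasureTheory ProbabilityTheory Filter Set

/-- Inverse CDF of the standard Laplace distribution: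
`F_L⁻¹(p) = log(2p)` for `p ≤ 1/2` and `-log(2(1-p))` for `p > 1/2`. -/
noncomputable def lapInv (p : ℝ) : ℝ :=
  if p ≤ 1/2 then Real.log (2 * p) else -Real.log (2 * (1 - p))

theorem stmt1 {Ω : Type*} [MeasurableSpace Ω] (μ : Measure Ω) [IsProbabilityMeasure μ]
    (X B : Ω → ℝ) (hXm : Measurable X) (hBm : Measurable B)
    (hX : ∀ x : ℝ, μ {ω | X ω ≤ x} = if x < 1 then 0 else ENNReal.ofReal (1 - 1 / x))
    (hBvals : ∀ ω, B ω = 0 ∨ B ω = 1)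
    (hB0 : μ {ω | B ω = 0} = 1/2) (hB1 : μ {ω | B ω = 1} = 1/2)
    (hindep : IndepFun B X μ)
    (Y : Ω → ℝ) (hY : ∀ ω, Y ω = B ω + (1 - B ω) * (2 - 1 / X ω))
    (XL YL : Ω → ℝ)
    (hXL : ∀ ω, XL ω = lapInv (1 - 1 / X ω))
    (hYL : ∀ ω, YL ω = lapInv ((μ {ω' | Y ω' ≤ Y ω}).toReal)) :
    ∀ᵐ ω ∂μ, (B ω = 0 ∧ 0 < XL ω → YL ω = Real.log 2 + XL ω) ∧
      (B ω = 1 → YL ω = 0) := by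
  have hX1 : ∀ᵐ ω ∂μ, 1 < X ω := by
    have h := hX 1
    simp only [lt_irrefl, if_false, div_one, sub_self, ENNReal.ofReal_zero] at h
    rw [ae_iff]
    simpa only [not_lt] using h
  have hcdf : ∀ x : ℝ, 1 ≤ x → (μ {ω | Y ω ≤ 2 - 1 / x}).toReal = 1 - 1 / (2 * x) := by
    intro x hx
    have hx0 : 0 < x := by linarith
    have hx1 : 1 / x ≤ 1 := by rw [div_le_one hx0]; exact hx
    have hset : {ω | Y ω ≤ 2 - 1 / x} =ᵐ[μ]
        ({ω | B ω = 1} ∪ ({ω | B ω = 0} ∩ {ω | X ω ≤ x}) : Set Ω) := by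
      filter_upwards [hX1] with ω hω
      apply propext
      change Y ω ≤ 2 - 1 / x ↔ B ω = 1 ∨ (B ω = 0 ∧ X ω ≤ x)
      rw [hY ω]
      rcases hBvals ω with h | h
      · have hiff := one_div_le_one_div hx0 (show 0 < X ω by linarith)
        simp only [h, zero_ne_one, false_or, true_and]
        rw [← hiff]
        constructor <;> intro h' <;> linarith
      · simp only [h, true_or, iff_true]
        linarith
    have hprod : μ ({ω | B ω = 0} ∩ {ω | X ω ≤ x}) = μ {ω | B ω = 0} * μ {ω | X ω ≤ x} :=
      hindep.measure_inter_preimage_eq_mul {0} (Iic x) (measurableSet_singleton 0)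
        measurableSet_Iic
    have hdisj : Disjoint {ω | B ω = 1} ({ω | B ω = 0} ∩ {ω | X ω ≤ x}) := by
      rw [Set.disjoint_left]
      rintro ω (h : B ω = 1) ⟨(h' : B ω = 0), -⟩
      linarith
    have hmeas : MeasurableSet ({ω | B ω = 0} ∩ {ω | X ω ≤ x}) :=
      (hBm (measurableSet_singleton 0)).inter (hXm measurableSet_Iic)
    rw [measure_congr hset, measure_union hdisj hmeas, hprod, hB0, hB1, hX x,
      if_neg (not_lt.mpr hx), ENNReal.toReal_add (by simp)
        (ENNReal.mul_ne_top (by simp) ENNReal.ofReal_ne_top), ENNReal.toReal_mul,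
      ENNReal.toReal_ofReal (by linarith)]
    simp only [ENNReal.toReal_div, ENNReal.toReal_one, ENNReal.toReal_ofNat]
    field_simp
    ring
  filter_upwards [hX1] with ω hω
  have hpos : 0 < X ω := by linarith
  have hinv : 1 / X ω < 1 := by rw [div_lt_one hpos]; exact hω
  refine ⟨fun ⟨hB, hXLpos⟩ => ?_, fun hB => ?_⟩
  · have hYω : Y ω = 2 - 1 / X ω := by rw [hY ω, hB]; ring
    have hhalf : 1 / (2 * X ω) = 1 / X ω / 2 := by field_simp
    rw [hXL ω, lapInv] at hXLpos
    rw [hYL ω, hXL ω, hYω, hcdf _ hω.le, lapInv, lapInv]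
    split_ifs at hXLpos with hp
    · have := Real.log_nonpos (x := 2 * (1 - 1 / X ω)) (by linarith) (by linarith)
      linarith
    · rw [if_neg (by rw [hhalf]; linarith), if_neg hp,
        show 2 * (1 - (1 - 1 / (2 * X ω))) = (X ω)⁻¹ by field_simp; ring,
        show 2 * (1 - (1 - 1 / X ω)) = 2 * (X ω)⁻¹ by field_simp; ring,
        Real.log_mul two_ne_zero (inv_ne_zero hpos.ne')]
      ring
  · have hYω : Y ω = 2 - 1 / 1 := by rw [hY ω, hB]; ring
    rw [hYL ω, hYω, hcdf 1 le_rfl, lapInv]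
    norm_num
end

section
/- Let X_P be a standard Pareto random variable, B an independent random variable uniform on {0,1}, Y = B + (1-B)(2 - 1/X_P), and let X_L = F_L^{-1}(1 - 1/X_P) and Y_L = F_L^{-1}(F_Y(Y)) be the Laplace-scale transforms, where F_Y is the CDF of Y. Then for every real z, lim_{t→∞} P(Y_L - X_L ≤ z | X_L > t) = (1/2)(1 + 1{z ≥ log 2}), i.e. the limit equals 1/2 for z < log 2 and equals 1 for z ≥ log 2. -/
open MeasureTheory ProbabilityTheory Filter Set

theorem lapInv_of_half_le {p : ℝ} (hp : 1 / 2 ≤ p) : lapInv p = -Real.log (2 * (1 - p)) := by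
  rcases hp.eq_or_lt with rfl | h
  · norm_num [lapInv]
  · rw [lapInv, if_neg (not_le.mpr h)]

theorem lapInv_one_sub_inv {x : ℝ} (h2 : 2 ≤ x) :
    lapInv (1 - 1 / x) = Real.log x - Real.log 2 := by
  have hp : 1 / 2 ≤ 1 - 1 / x := by
    have := one_div_le_one_div_of_le two_pos h2
    linarith
  have hx0 : x ≠ 0 := by linarith
  rw [lapInv_of_half_le hp, ← Real.log_inv, ← Real.log_div hx0 two_ne_zero]
  congr 1
  field_simp
  ring

/-- The Laplace transform of a Pareto value exceeds a nonnegative level `t` exactly when the value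
exceeds `2 * exp t`. -/
theorem lt_lapInv_one_sub_inv_iff {t x : ℝ} (ht : 0 ≤ t) (hx : 1 < x) :
    t < lapInv (1 - 1 / x) ↔ 2 * Real.exp t < x := by
  have hx0 : 0 < x := by linarith
  have he : 1 ≤ Real.exp t := Real.one_le_exp ht
  rcases le_or_gt 2 x with h2 | h2
  · rw [lapInv_one_sub_inv h2, ← Real.log_div hx0.ne' two_ne_zero,
      Real.lt_log_iff_exp_lt (by positivity), lt_div_iff₀ two_pos, mul_comm]
  · have hinv : 1 / 2 < 1 / x := one_div_lt_one_div_of_lt hx0 h2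
    have hle : 1 / x ≤ 1 := by rw [div_le_one hx0]; exact hx.le
    have hneg : lapInv (1 - 1 / x) ≤ 0 := by
      rw [lapInv, if_pos (by linarith)]
      exact Real.log_nonpos (by linarith) (by linarith)
    constructor <;> intro h <;> linarith

theorem lapInv_one_sub_half_inv {x : ℝ} (hx : 1 ≤ x) :
    lapInv (1 - 1 / (2 * x)) = Real.log x := by
  have hp : 1 / 2 ≤ 1 - 1 / (2 * x) := by
    have := one_div_le_one_div_of_le two_pos (show 2 ≤ 2 * x by linarith)
    linarith
  have hx0 : x ≠ 0 := by linarith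
  rw [lapInv_of_half_le hp, ← Real.log_inv]
  congr 1
  field_simp
  ring

theorem stmt2 {Ω : Type*} [MeasurableSpace Ω] (μ : Measure Ω) [IsProbabilityMeasure μ]
    (X B : Ω → ℝ) (hXm : Measurable X) (hBm : Measurable B)
    (hX : ∀ x : ℝ, μ {ω | X ω ≤ x} = if x < 1 then 0 else ENNReal.ofReal (1 - 1 / x))
    (hBvals : ∀ ω, B ω = 0 ∨ B ω = 1)
    (hB0 : μ {ω | B ω = 0} = 1/2) (hB1 : μ {ω | B ω = 1} = 1/2)
    (hindep : IndepFun B X μ)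
    (Y : Ω → ℝ) (hY : ∀ ω, Y ω = B ω + (1 - B ω) * (2 - 1 / X ω))
    (XL YL : Ω → ℝ)
    (hXL : ∀ ω, XL ω = lapInv (1 - 1 / X ω))
    (hYL : ∀ ω, YL ω = lapInv ((μ {ω' | Y ω' ≤ Y ω}).toReal)) :
    ∀ z : ℝ,
      Tendsto (fun t : ℝ =>
          (μ ({ω | YL ω - XL ω ≤ z} ∩ {ω | t < XL ω})).toReal / (μ {ω | t < XL ω}).toReal)
        atTop (nhds (if Real.log 2 ≤ z then 1 else 1/2)) := by
  have hX1 : ∀ᵐ ω ∂μ, 1 < X ω := by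
    rw [ae_iff]
    simpa using hX 1
  have hindep_set : ∀ (b : ℝ) (s : Set ℝ), MeasurableSet s →
      μ ({ω | B ω = b} ∩ {ω | X ω ∈ s}) = μ {ω | B ω = b} * μ {ω | X ω ∈ s} := fun b s hs =>
    hindep.measure_inter_preimage_eq_mul {b} s (measurableSet_singleton b) hs
  have hcdf : ∀ x : ℝ, 1 ≤ x → (μ {ω | Y ω ≤ 2 - 1 / x}).toReal = 1 - 1 / (2 * x) := by
    intro x hx
    have hx0 : 0 < x := by linarith
    have hinv : 1 / x ≤ 1 := by rw [div_le_one hx0]; exact hx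
    have hae : {ω | Y ω ≤ 2 - 1 / x} =ᵐ[μ]
        ({ω | B ω = 1} ∪ ({ω | B ω = 0} ∩ {ω | X ω ∈ Iic x}) : Set Ω) := by
      filter_upwards [hX1] with ω hω
      apply propext
      change Y ω ≤ 2 - 1 / x ↔ B ω = 1 ∨ (B ω = 0 ∧ X ω ≤ x)
      rw [hY]
      rcases hBvals ω with h | h
      · have := one_div_le_one_div hx0 (show 0 < X ω by linarith)
        simp only [h, zero_ne_one, false_or, true_and, ← this]
        constructor <;> intro h' <;> linarith
      · simp only [h, true_or, iff_true]
        linarith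
    have hdisj : Disjoint {ω | B ω = 1} ({ω | B ω = 0} ∩ {ω | X ω ∈ Iic x}) := by
      rw [Set.disjoint_left]
      intro ω h1 h0
      have h1' : B ω = 1 := h1
      have h0' : B ω = 0 := h0.1
      linarith
    have hXx : μ {ω | X ω ∈ Iic x} = ENNReal.ofReal (1 - 1 / x) := by
      have := hX x
      rwa [if_neg (not_lt.mpr hx)] at this
    rw [measure_congr hae, measure_union hdisj
      ((hBm (measurableSet_singleton 0)).inter (hXm measurableSet_Iic)),
      hindep_set 0 _ measurableSet_Iic, hB0, hB1, hXx, ENNReal.toReal_add (by simp)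
      (ENNReal.mul_ne_top (by simp) ENNReal.ofReal_ne_top), ENNReal.toReal_mul,
      ENNReal.toReal_ofReal (by linarith)]
    norm_num
    field_simp
    ring
  have hYL1 : ∀ ω, B ω = 1 → YL ω = 0 := by
    intro ω h
    have h1 := hcdf 1 le_rfl
    have h2 : Y ω = 2 - 1 / 1 := by rw [hY, h]; norm_num
    rw [hYL, h2, h1, lapInv_one_sub_half_inv le_rfl, Real.log_one]
  have hYL0 : ∀ ω, 1 < X ω → B ω = 0 → YL ω = Real.log (X ω) := by
    intro ω hx h
    have h2 : Y ω = 2 - 1 / X ω := by rw [hY, h]; ring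
    rw [hYL, h2, hcdf _ hx.le, lapInv_one_sub_half_inv hx.le]
  intro z
  refine tendsto_const_nhds.congr' ?_
  filter_upwards [eventually_ge_atTop 0, eventually_ge_atTop (-z)] with t ht htz
  have he : 1 ≤ Real.exp t := Real.one_le_exp ht
  have hA : {ω | t < XL ω} =ᵐ[μ] {ω | X ω ∈ Ioi (2 * Real.exp t)} := by
    filter_upwards [hX1] with ω hω
    apply propext
    change t < XL ω ↔ 2 * Real.exp t < X ω
    rw [hXL]
    exact lt_lapInv_one_sub_inv_iff ht hω
  have hpos : (μ {ω | t < XL ω}).toReal ≠ 0 := by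
    have hc : {ω | X ω ∈ Ioi (2 * Real.exp t)} = {ω | X ω ≤ 2 * Real.exp t}ᶜ := by
      ext ω; simp
    rw [measure_congr hA, hc]
    refine ENNReal.toReal_ne_zero.mpr ⟨?_, measure_ne_top _ _⟩
    rw [Ne, prob_compl_eq_zero_iff (measurableSet_le hXm measurable_const), hX,
      if_neg (by linarith), ENNReal.ofReal_eq_one]
    have : 0 < 1 / (2 * Real.exp t) := by positivity
    linarith
  have hdiff : ∀ ω, 1 < X ω → t < XL ω → B ω = 0 → YL ω - XL ω = Real.log 2 := by
    intro ω hω hlt h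
    rw [hXL, lt_lapInv_one_sub_inv_iff ht hω] at hlt
    rw [hYL0 ω hω h, hXL, lapInv_one_sub_inv (by linarith)]
    ring
  split_ifs with hz
  · have hI : ({ω | YL ω - XL ω ≤ z} ∩ {ω | t < XL ω} : Set Ω) =ᵐ[μ] {ω | t < XL ω} := by
      filter_upwards [hX1] with ω hω
      apply propext
      change (YL ω - XL ω ≤ z ∧ t < XL ω) ↔ t < XL ω
      refine and_iff_right_of_imp fun hlt => ?_
      rcases hBvals ω with h | h
      · rwa [hdiff ω hω hlt h]
      · rw [hYL1 ω h]
        linarith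
    rw [measure_congr hI, div_self hpos]
  · have hI : ({ω | YL ω - XL ω ≤ z} ∩ {ω | t < XL ω} : Set Ω) =ᵐ[μ]
        ({ω | B ω = 1} ∩ {ω | X ω ∈ Ioi (2 * Real.exp t)} : Set Ω) := by
      refine EventuallyEq.trans ?_ ((ae_eq_refl _).inter hA)
      filter_upwards [hX1] with ω hω
      apply propext
      change (YL ω - XL ω ≤ z ∧ t < XL ω) ↔ (B ω = 1 ∧ t < XL ω)
      refine and_congr_left fun hlt => ?_
      rcases hBvals ω with h | h
      · simp [hdiff ω hω hlt h, h, hz]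
      · simp only [h, hYL1 ω h, iff_true]
        linarith
    rw [measure_congr hI, hindep_set 1 _ measurableSet_Ioi, ← measure_congr hA, hB1,
      ENNReal.toReal_mul, mul_div_cancel_right₀ _ hpos]
    norm_num
end

section
/- Let X_P be a standard Pareto random variable, B an independent random variable uniform on {-1,1}, Y = 2 - B/X_P, and let X_L = F_L^{-1}(1 - 1/X_P) and Y_L = F_L^{-1}(F_Y(Y)) be the Laplace-scale transforms, where F_Y is the CDF of Y. Then almost surely on the event {X_L > 0}: if B = 1 then Y_L = log(1 - (1/2)e^{-X_L}), and if B = -1 then Y_L = -log(1 - (1/2)e^{-X_L}). -/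
open MeasureTheory ProbabilityTheory Filter Set

/-- The distribution function of a standard Pareto variable has no atoms, so the strict and the
weak distribution functions agree. -/
lemma measureReal_lt_of_pareto {Ω : Type*} [MeasurableSpace Ω] (μ : Measure Ω)
    [IsProbabilityMeasure μ] (X : Ω → ℝ)
    (hX : ∀ x : ℝ, 1 ≤ x → μ.real {ω | X ω ≤ x} = 1 - 1 / x) {x : ℝ} (hx : 1 < x) :
    μ.real {ω | X ω < x} = 1 - 1 / x := by
  apply le_antisymm
  · rw [← hX x hx.le]
    exact measureReal_mono fun ω (hω : X ω < x) => hω.le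
  · have hlim : Tendsto (fun t : ℝ => 1 - 1 / t) (nhdsWithin x (Iio x)) (nhds (1 - 1 / x)) := by
      apply Tendsto.mono_left _ nhdsWithin_le_nhds
      exact (continuousAt_const.sub (continuousAt_const.div continuousAt_id (by positivity)))
    refine le_of_tendsto hlim ?_
    filter_upwards [Ioo_mem_nhdsLT hx] with t ht
    rw [← hX t ht.1.le]
    exact measureReal_mono fun ω (hω : X ω ≤ t) => lt_of_le_of_lt hω ht.2

/-- On the positive half-line the Laplace quantile `lapInv (1 - u)` satisfies `exp (-lapInv (1 - u)) = 2 * u`. -/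
lemma exp_neg_lapInv_one_sub {u : ℝ} (hu0 : 0 < u) (hu1 : u < 1) (h : 0 < lapInv (1 - u)) :
    Real.exp (-lapInv (1 - u)) = 2 * u := by
  unfold lapInv at h ⊢
  split_ifs at h ⊢ with hu
  · exact absurd h (not_lt.mpr (Real.log_nonpos (by linarith) (by linarith)))
  · rw [neg_neg, sub_sub_cancel, Real.exp_log (by positivity)]

lemma lapInv_half_mul_one_sub {u : ℝ} (hu : 0 < u) :
    lapInv (1 / 2 * (1 - u)) = Real.log (1 - u) := by
  rw [lapInv, if_pos (by linarith)]
  congr 1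
  ring

lemma lapInv_one_sub_half_mul_one_sub {u : ℝ} (hu : 0 < u) :
    lapInv (1 - 1 / 2 * (1 - u)) = -Real.log (1 - u) := by
  rw [lapInv, if_neg (by linarith)]
  congr 2
  ring

theorem stmt4 {Ω : Type*} [MeasurableSpace Ω] (μ : Measure Ω) [IsProbabilityMeasure μ]
    (X B : Ω → ℝ) (hXm : Measurable X) (hBm : Measurable B)
    (hX : ∀ x : ℝ, μ {ω | X ω ≤ x} = if x < 1 then 0 else ENNReal.ofReal (1 - 1 / x))
    (hBvals : ∀ ω, B ω = -1 ∨ B ω = 1)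
    (hBneg : μ {ω | B ω = -1} = 1/2) (hB1 : μ {ω | B ω = 1} = 1/2)
    (hindep : IndepFun B X μ)
    (Y : Ω → ℝ) (hY : ∀ ω, Y ω = 2 - B ω / X ω)
    (XL YL : Ω → ℝ)
    (hXL : ∀ ω, XL ω = lapInv (1 - 1 / X ω))
    (hYL : ∀ ω, YL ω = lapInv ((μ {ω' | Y ω' ≤ Y ω}).toReal)) :
    ∀ᵐ ω ∂μ, 0 < XL ω →
      ((B ω = 1 → YL ω = Real.log (1 - Real.exp (-XL ω) / 2)) ∧
       (B ω = -1 → YL ω = -Real.log (1 - Real.exp (-XL ω) / 2))) := by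
  have hXr : ∀ x : ℝ, 1 ≤ x → μ.real {ω | X ω ≤ x} = 1 - 1 / x := by
    intro x hx
    have : 1 / x ≤ 1 := by rw [div_le_one (by positivity)]; exact hx
    rw [measureReal_def, hX, if_neg (not_lt.mpr hx), ENNReal.toReal_ofReal (by linarith)]
  have hX1 : ∀ᵐ ω ∂μ, 1 < X ω := by
    simp only [ae_iff, not_lt]
    simp [hX]
  have hprod : ∀ b : ℝ, ∀ s : Set ℝ, MeasurableSet s →
      μ.real {ω | B ω = b ∧ X ω ∈ s} = μ.real {ω | B ω = b} * μ.real {ω | X ω ∈ s} := by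
    intro b s hs
    simp only [measureReal_def, ← ENNReal.toReal_mul]
    congr 1
    exact hindep.measure_inter_preimage_eq_mul {b} s (measurableSet_singleton b) hs
  filter_upwards [hX1] with ω hω hpos
  have hx0 : 0 < X ω := by linarith
  have hu0 : 0 < 1 / X ω := by positivity
  have hu1 : 1 / X ω < 1 := by rw [div_lt_one hx0]; exact hω
  rw [hXL] at hpos
  have hexp : 1 - Real.exp (-XL ω) / 2 = 1 - 1 / X ω := by
    rw [hXL, exp_neg_lapInv_one_sub hu0 hu1 hpos]
    ring
  rw [hexp, hYL, ← measureReal_def]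
  constructor
  · intro hb
    have hset : μ.real {ω' | Y ω' ≤ Y ω} = μ.real {ω' | B ω' = 1 ∧ X ω' ∈ Iic (X ω)} := by
      apply measureReal_congr
      filter_upwards [hX1] with ω' hω'
      have hx0' : 0 < X ω' := by linarith
      apply propext
      change Y ω' ≤ Y ω ↔ B ω' = 1 ∧ X ω' ≤ X ω
      rw [hY, hY, hb, sub_le_sub_iff_left]
      rcases hBvals ω' with h | h <;> rw [h]
      · have : -1 / X ω' < 0 := div_neg_of_neg_of_pos (by norm_num) hx0'
        constructor
        · intro h'; linarith
        · intro h'; norm_num at h'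
      · rw [one_div_le_one_div hx0 hx0']
        simp
    have hF : μ.real {ω' | Y ω' ≤ Y ω} = 1 / 2 * (1 - 1 / X ω) := by
      rw [hset, hprod 1 _ measurableSet_Iic]
      simp only [mem_Iic]
      rw [hXr _ hω.le, measureReal_def, hB1]
      simp
    rw [hF, lapInv_half_mul_one_sub hu0]
  · intro hb
    have hYm : MeasurableSet {ω' | Y ω' ≤ Y ω} := by
      have : Measurable Y := by
        rw [funext hY]
        exact measurable_const.sub (hBm.div hXm)
      exact this measurableSet_Iic
    have hset : μ.real {ω' | Y ω' ≤ Y ω}ᶜ = μ.real {ω' | B ω' = -1 ∧ X ω' ∈ Iio (X ω)} := by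
      apply measureReal_congr
      filter_upwards [hX1] with ω' hω'
      have hx0' : 0 < X ω' := by linarith
      apply propext
      change ¬ Y ω' ≤ Y ω ↔ B ω' = -1 ∧ X ω' < X ω
      rw [hY, hY, hb, sub_le_sub_iff_left, not_le]
      rcases hBvals ω' with h | h <;> rw [h]
      · rw [neg_div, neg_div, neg_lt_neg_iff, one_div_lt_one_div hx0 hx0']
        simp
      · have : 0 < 1 / X ω' := by positivity
        have h2 : -1 / X ω < 0 := div_neg_of_neg_of_pos (by norm_num) hx0
        constructor
        · intro h'; linarith
        · intro h'; norm_num at h'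
    have hF : μ.real {ω' | Y ω' ≤ Y ω} = 1 - 1 / 2 * (1 - 1 / X ω) := by
      have hc := probReal_compl_eq_one_sub (μ := μ) hYm
      rw [hset, hprod (-1) _ measurableSet_Iio] at hc
      simp only [mem_Iio] at hc
      rw [measureReal_lt_of_pareto μ X hXr hω, measureReal_def, hBneg] at hc
      norm_num at hc ⊢
      linarith
    rw [hF, lapInv_one_sub_half_mul_one_sub hu0]
end

section
/- Let X_P be a standard Pareto random variable, B an independent random variable uniform on {-1,1}, Y = 2 - B/X_P, and let X_L and Y_L be the Laplace-scale transforms of X_P and Y. Then, without any normalisation, Y_L given X_L > t converges in probability to 0: for every ε > 0, lim_{t→∞} P(|Y_L| > ε | X_L > t) = 0. -/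
open MeasureTheory ProbabilityTheory Filter Set

/-- The Laplace quantile function is small near `1/2`. -/
lemma exists_abs_lapInv_lt {ε : ℝ} (hε : 0 < ε) :
    ∃ δ > 0, ∀ p : ℝ, |p - 1/2| < δ → |lapInv p| < ε := by
  have h1 : ContinuousAt (fun p : ℝ => Real.log (2 * p)) (1/2) :=
    ContinuousAt.log (by fun_prop) (by norm_num)
  have h2 : ContinuousAt (fun p : ℝ => -Real.log (2 * (1 - p))) (1/2) :=
    (ContinuousAt.log (by fun_prop) (by norm_num)).neg
  obtain ⟨d1, hd1, H1⟩ := Metric.continuousAt_iff.1 h1 ε hε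
  obtain ⟨d2, hd2, H2⟩ := Metric.continuousAt_iff.1 h2 ε hε
  refine ⟨min d1 d2, lt_min hd1 hd2, fun p hp => ?_⟩
  have k1 := H1 (x := p) (lt_of_lt_of_le hp (min_le_left _ _))
  have k2 := H2 (x := p) (lt_of_lt_of_le hp (min_le_right _ _))
  norm_num [Real.dist_eq] at k1 k2
  unfold lapInv
  split_ifs
  · exact k1
  · simpa using k2

/-- A large Laplace-scale value of a Pareto variable forces the variable itself to be large. -/
lemma two_mul_exp_lt_of_lt_lapInv {x t : ℝ} (hx : 1 ≤ x) (ht : 0 ≤ t)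
    (h : t < lapInv (1 - 1 / x)) : 2 * Real.exp t < x := by
  have hx0 : 0 < x := by linarith
  have hx1 : 1 / x ≤ 1 := by rw [div_le_one hx0]; exact hx
  unfold lapInv at h
  split_ifs at h with hp
  · have := Real.log_nonpos (x := 2 * (1 - 1 / x)) (by linarith) (by linarith)
    linarith
  · have h3 : 2 * (1 - (1 - 1 / x)) = (x / 2)⁻¹ := by field_simp; ring
    rw [h3, Real.log_inv, neg_neg, Real.lt_log_iff_exp_lt (by positivity)] at h
    linarith

/-- The distribution function of `2 - B / X` near `2` is close to `1/2`. -/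
lemma abs_cdf_two_sub_div_sub_half_le {Ω : Type*} [MeasurableSpace Ω] (μ : Measure Ω)
    [IsProbabilityMeasure μ] {X B : Ω → ℝ} (hX : ∀ᵐ ω ∂μ, 1 ≤ X ω)
    (hB : ∀ ω, B ω = -1 ∨ B ω = 1) (hB1 : μ.real {ω | B ω = 1} = 1/2)
    {M y : ℝ} (hM : 0 < M) (hy : |y - 2| < 1 / M) :
    |μ.real {ω | 2 - B ω / X ω ≤ y} - 1/2| ≤ μ.real {ω | M < X ω} := by
  obtain ⟨hy1, hy2⟩ := abs_lt.1 hy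
  have upper : μ.real {ω | 2 - B ω / X ω ≤ y} ≤ μ.real ({ω | B ω = 1} ∪ {ω | M < X ω}) := by
    refine ENNReal.toReal_mono (measure_ne_top _ _) (measure_mono_ae ?_)
    filter_upwards [hX] with ω hω h
    rcases hB ω with hb | hb
    · right
      have h : 2 - B ω / X ω ≤ y := h
      rw [hb, neg_div] at h
      exact (one_div_lt_one_div (by linarith) hM).1 (by linarith)
    · exact Or.inl hb
  have lower : μ.real {ω | B ω = 1} ≤
      μ.real ({ω | 2 - B ω / X ω ≤ y} ∪ {ω | M < X ω}) := by
    refine ENNReal.toReal_mono (measure_ne_top _ _) (measure_mono_ae ?_)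
    filter_upwards [hX] with ω hω h
    have hb : B ω = 1 := h
    rcases lt_or_ge M (X ω) with hm | hm
    · exact Or.inr hm
    · left
      have := one_div_le_one_div_of_le (by linarith) hm
      change 2 - B ω / X ω ≤ y
      rw [hb]
      linarith
  have u := measureReal_union_le (μ := μ) {ω | B ω = 1} {ω | M < X ω}
  have l := measureReal_union_le (μ := μ) {ω | 2 - B ω / X ω ≤ y} {ω | M < X ω}
  rw [abs_le]
  constructor <;> linarith

theorem stmt6 {Ω : Type*} [MeasurableSpace Ω] (μ : Measure Ω) [IsProbabilityMeasure μ]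
    (X B : Ω → ℝ) (hXm : Measurable X) (hBm : Measurable B)
    (hX : ∀ x : ℝ, μ {ω | X ω ≤ x} = if x < 1 then 0 else ENNReal.ofReal (1 - 1 / x))
    (hBvals : ∀ ω, B ω = -1 ∨ B ω = 1)
    (hBneg : μ {ω | B ω = -1} = 1/2) (hB1 : μ {ω | B ω = 1} = 1/2)
    (hindep : IndepFun B X μ)
    (Y : Ω → ℝ) (hY : ∀ ω, Y ω = 2 - B ω / X ω)
    (XL YL : Ω → ℝ)
    (hXL : ∀ ω, XL ω = lapInv (1 - 1 / X ω))
    (hYL : ∀ ω, YL ω = lapInv ((μ {ω' | Y ω' ≤ Y ω}).toReal)) :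
    ∀ ε : ℝ, 0 < ε →
      Tendsto (fun t : ℝ =>
          (μ ({ω | ε < |YL ω|} ∩ {ω | t < XL ω})).toReal / (μ {ω | t < XL ω}).toReal)
        atTop (nhds 0) := by
  intro ε hε
  obtain ⟨δ, hδ, hlap⟩ := exists_abs_lapInv_lt hε
  have hX1 : ∀ᵐ ω ∂μ, 1 ≤ X ω := by
    have key : ∀ᵐ ω ∂μ, ∀ n : ℕ, ¬ X ω ≤ 1 - 1 / ((n : ℝ) + 1) := by
      rw [ae_all_iff]
      intro n
      have hn : (0 : ℝ) < 1 / ((n : ℝ) + 1) := by positivity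
      rw [ae_iff]
      simp only [not_not]
      rw [hX, if_pos (by linarith)]
    filter_upwards [key] with ω h
    by_contra! hlt
    obtain ⟨n, hn⟩ := exists_nat_one_div_lt (sub_pos.2 hlt)
    exact h n (by linarith)
  have htail : ∀ M : ℝ, 1 ≤ M → μ.real {ω | M < X ω} = 1 / M := by
    intro M hM
    have hM1 : 1 / M ≤ 1 := by rw [div_le_one (by linarith)]; exact hM
    have hc : {ω | M < X ω} = {ω | X ω ≤ M}ᶜ := by ext; simp
    rw [hc, probReal_compl_eq_one_sub (measurableSet_le hXm measurable_const), measureReal_def,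
      hX, if_neg (by linarith), ENNReal.toReal_ofReal (by linarith)]
    ring
  have hB1' : μ.real {ω | B ω = 1} = 1/2 := by simp [measureReal_def, hB1]
  have hbig : ∀ᶠ t : ℝ in atTop, δ⁻¹ < Real.exp t :=
    Real.tendsto_exp_atTop.eventually_gt_atTop _
  refine tendsto_const_nhds.congr' ?_
  filter_upwards [hbig, eventually_ge_atTop 0] with t ht ht0
  have hM : 1 ≤ Real.exp t := Real.one_le_exp ht0
  have hnull : μ ({ω | ε < |YL ω|} ∩ {ω | t < XL ω}) = 0 := by
    rw [← compl_compl (_ ∩ _), ← mem_ae_iff]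
    filter_upwards [hX1] with ω hω
    rintro ⟨h1, h2⟩
    have h1 : ε < |YL ω| := h1
    have h2 : t < XL ω := h2
    rw [hXL] at h2
    have hx := two_mul_exp_lt_of_lt_lapInv hω ht0 h2
    have hy : |Y ω - 2| < 1 / Real.exp t := by
      have hYB : |Y ω - 2| = 1 / X ω := by
        have hBabs : |B ω| = 1 := by rcases hBvals ω with hb | hb <;> simp [hb]
        rw [hY, sub_sub_cancel_left, abs_neg, abs_div, hBabs, abs_of_pos (by linarith)]
      rw [hYB]
      exact one_div_lt_one_div_of_lt (by linarith) (by linarith)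
    have hF := abs_cdf_two_sub_div_sub_half_le μ hX1 hBvals hB1' (by linarith) hy
    rw [htail _ hM] at hF
    have hlt : 1 / Real.exp t < δ := by
      rw [one_div]
      exact inv_lt_of_inv_lt₀ hδ ht
    have hsmall := hlap _ (hF.trans_lt hlt)
    simp only [← hY] at hsmall
    rw [hYL] at h1
    exact lt_asymm h1 hsmall
  simp [hnull]
end

section
/- For each real s < 0 there is a unique y = y(s) ∈ (-1, 0) satisfying (y+1)(1 - log(y+1)) = e^{s} (the map y ↦ (y+1)(1 - log(y+1)) is strictly increasing on (-1,0) with range (0,1)), and the solution satisfies (y(s) + 1) · (-s) · e^{-s} → 1 as s → -∞; equivalently, y(s) + 1 is asymptotically equivalent to -e^{s}/s as s → -∞. -/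
open Filter Set

lemma continuous_mul_one_sub_log : Continuous fun x : ℝ => x * (1 - Real.log x) := by
  have h : Continuous fun x : ℝ => x - x * Real.log x :=
    continuous_id.sub Real.continuous_mul_log
  simpa only [mul_sub, mul_one] using h

lemma strictMonoOn_mul_one_sub_log :
    StrictMonoOn (fun x : ℝ => x * (1 - Real.log x)) (Icc 0 1) := by
  refine strictMonoOn_of_deriv_pos (convex_Icc 0 1) continuous_mul_one_sub_log.continuousOn ?_
  intro x hx
  rw [interior_Icc] at hx
  have hx0 : x ≠ 0 := hx.1.ne'
  have h : HasDerivAt (fun x : ℝ => x * (1 - Real.log x)) (-Real.log x) x := by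
    refine ((hasDerivAt_id' x).mul ((Real.hasDerivAt_log hx0).const_sub 1)).congr_deriv ?_
    field_simp
    ring
  rw [h.deriv]
  exact neg_pos.2 (Real.log_neg hx.1 hx.2)

lemma image_mul_one_sub_log_Ioo :
    (fun x : ℝ => x * (1 - Real.log x)) '' Ioo 0 1 = Ioo 0 1 := by
  apply Subset.antisymm
  · rintro _ ⟨x, hx, rfl⟩
    have h0 := strictMonoOn_mul_one_sub_log (left_mem_Icc.2 zero_le_one)
      (Ioo_subset_Icc_self hx) hx.1
    have h1 := strictMonoOn_mul_one_sub_log (Ioo_subset_Icc_self hx)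
      (right_mem_Icc.2 zero_le_one) hx.2
    simp only [zero_mul, Real.log_one, sub_zero, mul_one] at h0 h1
    exact ⟨h0, h1⟩
  · have h := intermediate_value_Ioo (zero_le_one (α := ℝ))
      continuous_mul_one_sub_log.continuousOn
    simpa only [zero_mul, Real.log_one, sub_zero, mul_one] using h

lemma tendsto_one_sub_one_add_log_div_atTop :
    Tendsto (fun w : ℝ => 1 - (1 + Real.log w) / w) atTop (nhds 1) := by
  have h := tendsto_inv_atTop_zero.add Real.isLittleO_log_id_atTop.tendsto_div_nhds_zero
  have h' := h.const_sub (1 : ℝ)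
  simp only [add_zero, sub_zero] at h'
  refine h'.congr fun w => ?_
  simp only [id, add_div, one_div]

theorem stmt9 :
    StrictMonoOn (fun y : ℝ => (y + 1) * (1 - Real.log (y + 1))) (Set.Ioo (-1 : ℝ) 0) ∧
    (fun y : ℝ => (y + 1) * (1 - Real.log (y + 1))) '' (Set.Ioo (-1 : ℝ) 0)
      = Set.Ioo (0 : ℝ) 1 ∧
    (∀ s : ℝ, s < 0 → ∃! y : ℝ, y ∈ Set.Ioo (-1 : ℝ) 0 ∧
      (y + 1) * (1 - Real.log (y + 1)) = Real.exp s) ∧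
    (∀ Y : ℝ → ℝ,
      (∀ s : ℝ, s < 0 → Y s ∈ Set.Ioo (-1 : ℝ) 0 ∧
        (Y s + 1) * (1 - Real.log (Y s + 1)) = Real.exp s) →
      Tendsto (fun s : ℝ => (Y s + 1) * (-s) * Real.exp (-s)) atBot (nhds 1)) := by
  have hmono : StrictMonoOn (fun y : ℝ => (y + 1) * (1 - Real.log (y + 1))) (Ioo (-1) 0) := by
    intro a ha b hb hab
    exact strictMonoOn_mul_one_sub_log ⟨by linarith [ha.1], by linarith [ha.2]⟩
      ⟨by linarith [hb.1], by linarith [hb.2]⟩ (by linarith : a + 1 < b + 1)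
  have himage : (fun y : ℝ => (y + 1) * (1 - Real.log (y + 1))) '' Ioo (-1) 0 = Ioo 0 1 := by
    have h : (fun y : ℝ => y + 1) '' Ioo (-1) 0 = Ioo 0 1 := by simp
    rw [← image_mul_one_sub_log_Ioo, ← h, image_image]
  refine ⟨hmono, himage, fun s hs => ?_, fun Y hY => ?_⟩
  · have hmem : Real.exp s ∈ Ioo (0 : ℝ) 1 := ⟨Real.exp_pos s, Real.exp_lt_one_iff.2 hs⟩
    rw [← himage] at hmem
    obtain ⟨y, hy, hys⟩ := hmem
    exact ⟨y, ⟨hy, hys⟩, fun z hz => hmono.injOn hz.1 hy (hz.2.trans hys.symm)⟩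
  · have key : ∀ s < 0, 1 < 1 - Real.log (Y s + 1) ∧
        s = 1 - (1 - Real.log (Y s + 1)) + Real.log (1 - Real.log (Y s + 1)) := by
      intro s hs
      obtain ⟨hy, hys⟩ := hY s hs
      have hu : 0 < Y s + 1 := by linarith [hy.1]
      have hlog : Real.log (Y s + 1) < 0 := Real.log_neg hu (by linarith [hy.2])
      refine ⟨by linarith, ?_⟩
      have h := congrArg Real.log hys
      rw [Real.log_exp, Real.log_mul hu.ne' (by linarith)] at h
      linarith
    have hw : Tendsto (fun s => 1 - Real.log (Y s + 1)) atBot atTop := by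
      refine tendsto_atTop_mono' _ ?_ tendsto_neg_atBot_atTop
      filter_upwards [eventually_lt_atBot 0] with s hs
      obtain ⟨h1, h2⟩ := key s hs
      linarith [Real.log_pos h1]
    refine (tendsto_one_sub_one_add_log_div_atTop.comp hw).congr' ?_
    filter_upwards [eventually_lt_atBot 0] with s hs
    obtain ⟨h1, h2⟩ := key s hs
    have hys := (hY s hs).2
    have hy := (hY s hs).1.1
    have hu : Y s + 1 ≠ 0 := by linarith
    simp only [Function.comp_apply]
    rw [Real.exp_neg, ← hys]
    generalize 1 - Real.log (Y s + 1) = w at h1 h2 ⊢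
    have hw0 : w ≠ 0 := by linarith
    field_simp
    linarith
end

section
/- Define g(x) = x(2 + sin log x) for x ≥ 1; then g is strictly increasing on [1,∞) with g(1) = 2 and g(x) → ∞, so its inverse g^{-1}: [2,∞) → [1,∞) exists. Let X_P be a standard Pareto random variable and B an independent random variable uniform on {0,1}, and set Y = B·X_P + (1-B)·(-g^{-1}(2·X_P)). Then P(Y ≤ y) = 1/g(-y) for y ≤ -1, P(Y ≤ y) = 1/2 for -1 ≤ y ≤ 1, and P(Y ≤ y) = 1 - 1/(2y) for y ≥ 1. -/
open MeasureTheory ProbabilityTheory Filter Set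

/-- `x (2 + sin (log x))` has derivative `2 + sin (log x) + cos (log x) > 0` on `[1, ∞)`. -/
theorem strictMonoOn_mul_two_add_sin_log :
    StrictMonoOn (fun x : ℝ => x * (2 + Real.sin (Real.log x))) (Ici 1) := by
  have hd : ∀ x : ℝ, 1 ≤ x → HasDerivAt (fun x : ℝ => x * (2 + Real.sin (Real.log x)))
      (2 + Real.sin (Real.log x) + Real.cos (Real.log x)) x := by
    intro x hx
    have hx0 : x ≠ 0 := by positivity
    have h := (hasDerivAt_id x).mul (((Real.hasDerivAt_log hx0).sin).const_add 2)
    refine h.congr_deriv ?_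
    simp only [id]
    field_simp
  refine strictMonoOn_of_deriv_pos (convex_Ici 1)
    (fun x hx => (hd x hx).continuousAt.continuousWithinAt) ?_
  intro x hx
  rw [interior_Ici] at hx
  rw [(hd x (le_of_lt hx)).deriv]
  nlinarith [Real.sin_sq_add_cos_sq (Real.log x),
    sq_nonneg (Real.sin (Real.log x) - Real.cos (Real.log x))]

theorem tendsto_mul_two_add_sin_log_atTop :
    Tendsto (fun x : ℝ => x * (2 + Real.sin (Real.log x))) atTop atTop := by
  refine tendsto_atTop_mono' atTop ?_ tendsto_id
  filter_upwards [eventually_ge_atTop (0 : ℝ)] with x hx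
  have := Real.neg_one_le_sin (Real.log x)
  simp only [id]
  nlinarith

/-- The strict distribution function of a standard Pareto variable. -/
theorem measure_lt_of_pareto {Ω : Type*} [MeasurableSpace Ω] {μ : Measure Ω} {X : Ω → ℝ}
    (hX : ∀ x : ℝ, μ {ω | X ω ≤ x} = if x < 1 then 0 else ENNReal.ofReal (1 - 1 / x))
    {c : ℝ} (hc : 1 ≤ c) : μ {ω | X ω < c} = ENNReal.ofReal (1 - 1 / c) := by
  apply le_antisymm
  · calc μ {ω | X ω < c} ≤ μ {ω | X ω ≤ c} := measure_mono fun ω (h : X ω < c) => h.le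
      _ = _ := by rw [hX, if_neg hc.not_gt]
  · have hcont : ContinuousAt (fun x : ℝ => ENNReal.ofReal (1 - 1 / x)) c := by
      refine ENNReal.continuous_ofReal.continuousAt.comp ?_
      have : c ≠ 0 := by positivity
      fun_prop (disch := assumption)
    refine le_of_tendsto (hcont.tendsto.mono_left (nhdsWithin_le_nhds (s := Iio c))) ?_
    have hpos : ∀ᶠ x in nhdsWithin c (Iio c), 0 < x :=
      nhdsWithin_le_nhds (eventually_gt_nhds (by linarith))
    filter_upwards [hpos, self_mem_nhdsWithin] with x hx0 hxc
    rcases lt_or_ge x 1 with h | h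
    · have : 1 - 1 / x ≤ 0 := by
        rw [sub_nonpos, le_div_iff₀ hx0]
        linarith
      rw [ENNReal.ofReal_of_nonpos this]
      exact zero_le
    · calc ENNReal.ofReal (1 - 1 / x) = μ {ω | X ω ≤ x} := by rw [hX, if_neg h.not_gt]
        _ ≤ _ := measure_mono fun ω (hω : X ω ≤ x) => lt_of_le_of_lt hω hxc

theorem measure_ge_of_pareto {Ω : Type*} [MeasurableSpace Ω] {μ : Measure Ω}
    [IsProbabilityMeasure μ] {X : Ω → ℝ} (hXm : Measurable X)
    (hX : ∀ x : ℝ, μ {ω | X ω ≤ x} = if x < 1 then 0 else ENNReal.ofReal (1 - 1 / x))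
    {c : ℝ} (hc : 1 ≤ c) : μ (X ⁻¹' Ici c) = ENNReal.ofReal (1 / c) := by
  have h : X ⁻¹' Ici c = {ω | X ω < c}ᶜ := by
    ext ω
    simp
  have hc1 : 1 / c ≤ 1 := by
    rw [div_le_one (by linarith)]
    exact hc
  rw [h, prob_compl_eq_one_sub (measurableSet_lt hXm measurable_const),
    measure_lt_of_pareto hX hc, ← ENNReal.ofReal_one, ← ENNReal.ofReal_sub _ (by linarith)]
  congr 1
  ring

/-- Conditioning on a fair coin `B` independent of `X`. -/
theorem measure_eq_of_fair_coin {Ω : Type*} [MeasurableSpace Ω] {μ : Measure Ω}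
    {X B : Ω → ℝ} (hXm : Measurable X) (hBm : Measurable B)
    (hBvals : ∀ ω, B ω = 0 ∨ B ω = 1)
    (hB0 : μ {ω | B ω = 0} = 1/2) (hB1 : μ {ω | B ω = 1} = 1/2)
    (hindep : IndepFun B X μ) {A : Set Ω} {S T : Set ℝ}
    (hS : MeasurableSet S) (hT : MeasurableSet T)
    (h0 : ∀ᵐ ω ∂μ, B ω = 0 → (ω ∈ A ↔ X ω ∈ S))
    (h1 : ∀ᵐ ω ∂μ, B ω = 1 → (ω ∈ A ↔ X ω ∈ T)) :
    μ A = 1/2 * μ (X ⁻¹' S) + 1/2 * μ (X ⁻¹' T) := by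
  have hA : A =ᵐ[μ] (B ⁻¹' {0} ∩ X ⁻¹' S ∪ B ⁻¹' {1} ∩ X ⁻¹' T : Set Ω) := by
    rw [eventuallyEq_set]
    filter_upwards [h0, h1] with ω h0 h1
    rcases hBvals ω with h | h
    · simp [h, h0 h]
    · simp [h, h1 h]
  have hdisj : Disjoint (B ⁻¹' {0} ∩ X ⁻¹' S) (B ⁻¹' {1} ∩ X ⁻¹' T) := by
    rw [Set.disjoint_left]
    rintro ω ⟨h, -⟩ ⟨h', -⟩
    simp only [mem_preimage, mem_singleton_iff] at h h'
    linarith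
  rw [measure_congr hA,
    measure_union hdisj ((hBm (measurableSet_singleton 1)).inter (hXm hT)),
    hindep.measure_inter_preimage_eq_mul _ _ (measurableSet_singleton 0) hS,
    hindep.measure_inter_preimage_eq_mul _ _ (measurableSet_singleton 1) hT]
  congr 2

theorem stmt11 {Ω : Type*} [MeasurableSpace Ω] (μ : Measure Ω) [IsProbabilityMeasure μ]
    (X B : Ω → ℝ) (hXm : Measurable X) (hBm : Measurable B)
    (hX : ∀ x : ℝ, μ {ω | X ω ≤ x} = if x < 1 then 0 else ENNReal.ofReal (1 - 1 / x))
    (hBvals : ∀ ω, B ω = 0 ∨ B ω = 1)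
    (hB0 : μ {ω | B ω = 0} = 1/2) (hB1 : μ {ω | B ω = 1} = 1/2)
    (hindep : IndepFun B X μ)
    (g : ℝ → ℝ) (hg : ∀ x : ℝ, g x = x * (2 + Real.sin (Real.log x)))
    (ginv : ℝ → ℝ)
    (hginv1 : ∀ x : ℝ, 1 ≤ x → ginv (g x) = x)
    (hginv2 : ∀ y : ℝ, 2 ≤ y → 1 ≤ ginv y ∧ g (ginv y) = y)
    (Y : Ω → ℝ) (hY : ∀ ω, Y ω = B ω * X ω + (1 - B ω) * (-(ginv (2 * X ω)))) :
    StrictMonoOn g (Set.Ici (1 : ℝ)) ∧ g 1 = 2 ∧ Tendsto g atTop atTop ∧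
    (∀ y : ℝ, y ≤ -1 → μ {ω | Y ω ≤ y} = ENNReal.ofReal (1 / g (-y))) ∧
    (∀ y : ℝ, -1 ≤ y → y ≤ 1 → μ {ω | Y ω ≤ y} = 1/2) ∧
    (∀ y : ℝ, 1 ≤ y → μ {ω | Y ω ≤ y} = ENNReal.ofReal (1 - 1 / (2 * y))) := by
  have hgfun : g = fun x : ℝ => x * (2 + Real.sin (Real.log x)) := funext hg
  have hmono : StrictMonoOn g (Ici (1 : ℝ)) := hgfun ▸ strictMonoOn_mul_two_add_sin_log
  have hg1 : g 1 = 2 := by simp [hg]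
  have hX1 : ∀ᵐ ω ∂μ, 1 ≤ X ω := by
    have h : μ {ω | X ω < 1} = 0 := by simp [measure_lt_of_pareto hX le_rfl]
    simpa [ae_iff] using h
  have hY0 : ∀ ω, B ω = 0 → Y ω = -ginv (2 * X ω) := fun ω h => by simp [hY, h]
  have hY1 : ∀ ω, B ω = 1 → Y ω = X ω := fun ω h => by simp [hY, h]
  have hginv_ge : ∀ ω, 1 ≤ X ω → 1 ≤ ginv (2 * X ω) := fun ω h =>
    (hginv2 _ (by linarith)).1
  have hhalf : (1 / 2 : ENNReal) = ENNReal.ofReal (1 / 2) := by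
    rw [ENNReal.ofReal_div_of_pos two_pos]
    simp
  have hright : ∀ y : ℝ, -1 ≤ y → μ {ω | Y ω ≤ y} = 1/2 + 1/2 * μ {ω | X ω ≤ y} := by
    intro y hy
    rw [measure_eq_of_fair_coin (A := {ω | Y ω ≤ y}) hXm hBm hBvals hB0 hB1 hindep
      MeasurableSet.univ (measurableSet_Iic (a := y)) ?_ ?_]
    · simp [preimage, measure_univ]
    · filter_upwards [hX1] with ω hω hb
      have := hginv_ge ω hω
      simp only [hY0 ω hb, mem_univ, iff_true]
      linarith
    · filter_upwards with ω hb
      simp [hY1 ω hb]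
  refine ⟨hmono, hg1, hgfun ▸ tendsto_mul_two_add_sin_log_atTop, ?_, ?_, ?_⟩
  · intro y hy
    have hy1 : (1 : ℝ) ≤ -y := by linarith
    have hgy : 2 ≤ g (-y) := hg1 ▸ hmono.monotoneOn self_mem_Ici hy1 hy1
    rw [measure_eq_of_fair_coin (A := {ω | Y ω ≤ y}) hXm hBm hBvals hB0 hB1 hindep
      (measurableSet_Ici (a := g (-y) / 2)) MeasurableSet.empty ?_ ?_]
    · rw [measure_ge_of_pareto hXm hX (by linarith), hhalf,
        ← ENNReal.ofReal_mul (by norm_num)]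
      simp only [preimage_empty, measure_empty, mul_zero, add_zero]
      congr 1
      field_simp
    · filter_upwards [hX1] with ω hω hb
      obtain ⟨h1, h2⟩ := hginv2 (2 * X ω) (by linarith)
      have h3 := hmono.le_iff_le (a := -y) hy1 h1
      rw [h2] at h3
      simp only [hY0 ω hb, mem_Ici]
      rw [neg_le, ← h3, div_le_iff₀ two_pos, mul_comm]
    · filter_upwards [hX1] with ω hω hb
      simp only [hY1 ω hb, mem_empty_iff_false, iff_false, not_le]
      linarith
  · intro y hy hy1
    have h : μ {ω | X ω ≤ y} = 0 := by
      rw [hX]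
      split_ifs with h
      · rfl
      · simp [le_antisymm hy1 (not_lt.mp h)]
    rw [hright y hy, h, mul_zero, add_zero]
  · intro y hy
    have hy' : 1 / y ≤ 1 := by
      rw [div_le_one (by linarith)]
      exact hy
    rw [hright y (by linarith), hX, if_neg hy.not_gt, hhalf,
      ← ENNReal.ofReal_mul (by norm_num),
      ← ENNReal.ofReal_add (by norm_num) (by linarith)]
    congr 1
    have : y ≠ 0 := by positivity
    field_simp
    ring
end

section
/- Define g_c(u) = u(1 + c sin log u) for 0 < u ≤ 1 and |c| < 1/√2, and ψ_c(z) = g_c^{-1}(1/z) for z ≥ 1. Let Z_P be a standard Pareto random variable and B an independent random variable uniform on {1,2,3,4}, and define (X,Y) = (2-ψ_{1/2}(Z_P), 2-1/Z_P) if B=1; (2-ψ_{-1/2}(Z_P), 2-1/√Z_P) if B=2; (1-1/Z_P, 2-1/Z_P) if B=3; (2-1/Z_P, 1-1/Z_P) if B=4. Then P(X ≤ x) = x/4 for 0 ≤ x ≤ 1 and P(X ≤ x) = 3x/4 - 1/2 for 1 ≤ x ≤ 2. -/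
open MeasureTheory ProbabilityTheory Filter Set

/-- `g_c(u) = u (1 + c sin log u)`. -/
noncomputable def gc (c u : ℝ) : ℝ := u * (1 + c * Real.sin (Real.log u))

theorem hasDerivAt_gc (c : ℝ) {u : ℝ} (hu : 0 < u) :
    HasDerivAt (gc c)
      (1 + c * Real.sin (Real.log u) + c * Real.cos (Real.log u)) u := by
  have h : HasDerivAt (fun u => u * (1 + c * Real.sin (Real.log u)))
      (1 * (1 + c * Real.sin (Real.log u)) + u * (c * (Real.cos (Real.log u) * u⁻¹))) u :=
    (hasDerivAt_id' u).mul
      ((((Real.hasDerivAt_log hu.ne').sin).const_mul c).const_add 1)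
  have he : 1 + c * Real.sin (Real.log u) + c * Real.cos (Real.log u) =
      1 * (1 + c * Real.sin (Real.log u)) + u * (c * (Real.cos (Real.log u) * u⁻¹)) := by
    field_simp
  rw [he]
  exact h

theorem gc_strictMonoOn_Ioi {c : ℝ} (hc : |c| ≤ 1 / 2) : StrictMonoOn (gc c) (Ioi 0) := by
  refine strictMonoOn_of_deriv_pos (convex_Ioi 0)
    (fun u hu => (hasDerivAt_gc c hu).continuousAt.continuousWithinAt) fun u hu => ?_
  rw [interior_Ioi] at hu
  rw [(hasDerivAt_gc c hu).deriv]
  have h := Real.sin_sq_add_cos_sq (Real.log u)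
  set s := Real.sin (Real.log u)
  set t := Real.cos (Real.log u)
  have hst : |s + t| < 2 := abs_lt_of_sq_lt_sq (by nlinarith [sq_nonneg (s - t)]) (by norm_num)
  have hmul : |c * (s + t)| < 1 := by
    rw [abs_mul]
    nlinarith [abs_nonneg c, abs_nonneg (s + t)]
  linarith [(abs_lt.mp hmul).1]

theorem gc_zero (c : ℝ) : gc c 0 = 0 := by simp [gc]

theorem gc_one (c : ℝ) : gc c 1 = 1 := by simp [gc]

theorem gc_strictMonoOn {c : ℝ} (hc : |c| ≤ 1 / 2) : StrictMonoOn (gc c) (Ici 0) := by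
  intro u hu v hv huv
  rcases (mem_Ici.mp hu).eq_or_lt with rfl | hu
  · rw [gc_zero]
    have h : |c * Real.sin (Real.log v)| ≤ 1 / 2 := by
      rw [abs_mul]
      nlinarith [abs_nonneg c, Real.abs_sin_le_one (Real.log v)]
    exact mul_pos huv (by linarith [(abs_le.mp h).1])
  · exact gc_strictMonoOn_Ioi hc hu (hu.trans huv) huv

theorem gc_mem_Icc {c : ℝ} (hc : |c| ≤ 1 / 2) {u : ℝ} (h0 : 0 ≤ u) (h1 : u ≤ 1) :
    gc c u ∈ Icc 0 1 := by
  have hmono := (gc_strictMonoOn hc).monotoneOn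
  refine ⟨?_, ?_⟩
  · simpa [gc_zero] using hmono (mem_Ici.mpr le_rfl) h0 h0
  · simpa [gc_one] using hmono h0 (mem_Ici.mpr zero_le_one) h1

/-- If `1 / Z` is uniform on `(0, 1]`, `B` is uniform on `{1, 2, 3, 4}` and independent of `Z`,
then the event `a (B ω) ≤ 1 / Z ω` has probability the average of the `1 - a i`. -/
theorem measure_of_iff_threshold {Ω : Type*} [MeasurableSpace Ω] (μ : Measure Ω)
    (Z : Ω → ℝ) (B : Ω → ℕ) (hZm : Measurable Z) (hBm : Measurable B)
    (hZ : ∀ z : ℝ, μ {ω | Z ω ≤ z} = if z < 1 then 0 else ENNReal.ofReal (1 - 1 / z))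
    (hZuniv : μ univ = 1)
    (hBvals : ∀ ω, B ω = 1 ∨ B ω = 2 ∨ B ω = 3 ∨ B ω = 4)
    (hBunif : ∀ i : ℕ, 1 ≤ i → i ≤ 4 → μ {ω | B ω = i} = 1/4)
    (hindep : IndepFun B Z μ) (a : ℕ → ℝ) (ha : ∀ i ∈ Finset.Icc 1 4, a i ∈ Icc (0 : ℝ) 1)
    (p : Ω → Prop) (hp : ∀ ω, 1 < Z ω → (p ω ↔ a (B ω) ≤ 1 / Z ω)) :
    μ {ω | p ω} = ENNReal.ofReal ((∑ i ∈ Finset.Icc 1 4, (1 - a i)) / 4) := by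
  have hZ1 : ∀ᵐ ω ∂μ, 1 < Z ω := by
    have h : μ {ω | Z ω ≤ 1} = 0 := by simp [hZ]
    rw [ae_iff]
    simpa using h
  have hthr : ∀ t ∈ Icc (0 : ℝ) 1, μ {ω | t ≤ 1 / Z ω} = ENNReal.ofReal (1 - t) := by
    rintro t ⟨h0, h1⟩
    rcases h0.eq_or_lt with rfl | h0
    · rw [sub_zero, ENNReal.ofReal_one, ← hZuniv]
      refine measure_congr (Filter.eventuallyEq_set.mpr ?_)
      filter_upwards [hZ1] with ω hω
      have : 0 ≤ 1 / Z ω := by positivity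
      simpa using this
    · have h : μ {ω | t ≤ 1 / Z ω} = μ {ω | Z ω ≤ 1 / t} := by
        refine measure_congr (Filter.eventuallyEq_set.mpr ?_)
        filter_upwards [hZ1] with ω hω
        exact le_one_div h0 (by linarith)
      rw [h, hZ, if_neg (not_lt.mpr ((one_le_div h0).mpr h1)), one_div_one_div]
  have hset : μ {ω | p ω} =
      μ (⋃ i ∈ Finset.Icc 1 4, B ⁻¹' {i} ∩ Z ⁻¹' {z | a i ≤ 1 / z}) := by
    refine measure_congr (Filter.eventuallyEq_set.mpr ?_)
    filter_upwards [hZ1] with ω hω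
    have hB : B ω ∈ Finset.Icc 1 4 := by
      rw [Finset.mem_Icc]
      have := hBvals ω
      omega
    simp only [mem_ofPred_eq, mem_iUnion, mem_inter_iff, mem_preimage, mem_singleton_iff,
      exists_prop, hp ω hω]
    exact ⟨fun h => ⟨B ω, hB, rfl, h⟩, by rintro ⟨i, -, rfl, h⟩; exact h⟩
  have hmeas : ∀ t : ℝ, MeasurableSet {z : ℝ | t ≤ 1 / z} := fun t =>
    measurableSet_le measurable_const (measurable_const.div measurable_id)
  rw [hset, measure_biUnion_finset, Finset.sum_div,
    ENNReal.ofReal_sum_of_nonneg fun i hi => by linarith [(ha i hi).2]]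
  · refine Finset.sum_congr rfl fun i hi => ?_
    rw [hindep.measure_inter_preimage_eq_mul _ _ (measurableSet_singleton i) (hmeas _)]
    have hi' := Finset.mem_Icc.mp hi
    have h1 : μ (B ⁻¹' {i}) = 1 / 4 := hBunif i hi'.1 hi'.2
    have h2 : μ (Z ⁻¹' {z | a i ≤ 1 / z}) = ENNReal.ofReal (1 - a i) := hthr _ (ha i hi)
    rw [h1, h2, ENNReal.ofReal_div_of_pos (by norm_num), mul_comm, mul_one_div]
    norm_num
  · intro i _ j _ hij
    refine Disjoint.mono inter_subset_left inter_subset_left ?_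
    exact Disjoint.preimage B (disjoint_singleton.mpr hij)
  · exact fun i _ => (hBm (measurableSet_singleton i)).inter (hZm (hmeas _))

theorem stmt14 {Ω : Type*} [MeasurableSpace Ω] (μ : Measure Ω) [IsProbabilityMeasure μ]
    (Z : Ω → ℝ) (B : Ω → ℕ) (hZm : Measurable Z) (hBm : Measurable B)
    (hZ : ∀ z : ℝ, μ {ω | Z ω ≤ z} = if z < 1 then 0 else ENNReal.ofReal (1 - 1 / z))
    (hBvals : ∀ ω, B ω = 1 ∨ B ω = 2 ∨ B ω = 3 ∨ B ω = 4)
    (hBunif : ∀ i : ℕ, 1 ≤ i → i ≤ 4 → μ {ω | B ω = i} = 1/4)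
    (hindep : IndepFun B Z μ)
    (ψhalf ψneg : ℝ → ℝ)
    (hψhalf : ∀ z : ℝ, 1 ≤ z →
      0 < ψhalf z ∧ ψhalf z ≤ 1 ∧ gc (1/2) (ψhalf z) = 1 / z)
    (hψneg : ∀ z : ℝ, 1 ≤ z →
      0 < ψneg z ∧ ψneg z ≤ 1 ∧ gc (-(1/2)) (ψneg z) = 1 / z)
    (X Y : Ω → ℝ)
    (hXdef : ∀ ω, X ω =
      if B ω = 1 then 2 - ψhalf (Z ω)
      else if B ω = 2 then 2 - ψneg (Z ω)
      else if B ω = 3 then 1 - 1 / Z ω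
      else 2 - 1 / Z ω)
    (hYdef : ∀ ω, Y ω =
      if B ω = 2 then 2 - 1 / Real.sqrt (Z ω)
      else if B ω = 4 then 1 - 1 / Z ω
      else 2 - 1 / Z ω) :
    (∀ x : ℝ, 0 ≤ x → x ≤ 1 → μ {ω | X ω ≤ x} = ENNReal.ofReal (x / 4)) ∧
    (∀ x : ℝ, 1 ≤ x → x ≤ 2 → μ {ω | X ω ≤ x} = ENNReal.ofReal (3 * x / 4 - 1/2)) := by
  have hc₁ : |(1 / 2 : ℝ)| ≤ 1 / 2 := by rw [abs_of_pos] <;> norm_num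
  have hc₂ : |(-(1 / 2) : ℝ)| ≤ 1 / 2 := by rw [abs_neg]; exact hc₁
  have key := measure_of_iff_threshold μ Z B hZm hBm hZ measure_univ hBvals hBunif hindep
  refine ⟨fun x h0 h1 => ?_, fun x h1 h2 => ?_⟩
  · rw [key (fun i => if i = 3 then 1 - x else 1) ?_ (fun ω => X ω ≤ x) ?_]
    · congr 1
      norm_num [Finset.sum_Icc_succ_top]
      ring
    · intro i _
      split_ifs
      · exact ⟨by linarith, by linarith⟩
      · exact ⟨zero_le_one, le_rfl⟩
    · intro ω hω
      have hinv : 1 / Z ω < 1 := (div_lt_one (by linarith)).mpr hω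
      have hlt : ∀ c v : ℝ, v ≤ 1 → gc c v = 1 / Z ω → v < 1 := by
        intro c v hv hg
        refine lt_of_le_of_ne hv ?_
        rintro rfl
        rw [gc_one] at hg
        linarith
      obtain ⟨-, hp1, hp2⟩ := hψhalf (Z ω) hω.le
      obtain ⟨-, hn1, hn2⟩ := hψneg (Z ω) hω.le
      have hp := hlt _ _ hp1 hp2
      have hn := hlt _ _ hn1 hn2
      rw [hXdef]
      rcases hBvals ω with h | h | h | h <;> simp only [h] <;> norm_num only [if_true, if_false] <;>
        constructor <;> intro h' <;> linarith
  · rw [key (fun i => if i = 1 then gc (1 / 2) (2 - x) else if i = 2 then gc (-(1 / 2)) (2 - x)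
      else if i = 3 then 0 else 2 - x) ?_ (fun ω => X ω ≤ x) ?_]
    · congr 1
      norm_num [Finset.sum_Icc_succ_top, gc]
      ring
    · intro i _
      split_ifs
      · exact gc_mem_Icc hc₁ (by linarith) (by linarith)
      · exact gc_mem_Icc hc₂ (by linarith) (by linarith)
      · exact ⟨le_rfl, zero_le_one⟩
      · exact ⟨by linarith, by linarith⟩
    · intro ω hω
      have hpos : 0 < 1 / Z ω := one_div_pos.mpr (by linarith)
      obtain ⟨hp0, -, hp2⟩ := hψhalf (Z ω) hω.le
      obtain ⟨hn0, -, hn2⟩ := hψneg (Z ω) hω.le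
      have hx : 2 - x ∈ Ici (0 : ℝ) := mem_Ici.mpr (by linarith)
      have hp := (gc_strictMonoOn hc₁).le_iff_le hx hp0.le
      have hn := (gc_strictMonoOn hc₂).le_iff_le hx hn0.le
      rw [hp2] at hp
      rw [hn2] at hn
      rw [hXdef]
      rcases hBvals ω with h | h | h | h
      · simp only [h, if_true]
        rw [hp, sub_le_comm]
      · simp only [h, if_true, OfNat.ofNat_ne_one, if_false]
        rw [hn, sub_le_comm]
      · simp only [h]
        norm_num only [if_true, if_false]
        constructor <;> intro h' <;> linarith
      · simp only [h]
        norm_num only [if_true, if_false]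
        constructor <;> intro h' <;> linarith
end

section
/- Define g_c(u) = u(1 + c sin log u) for 0 < u ≤ 1 and |c| < 1/√2, and ψ_c(z) = g_c^{-1}(1/z) for z ≥ 1. Let Z_P be a standard Pareto random variable and B an independent random variable uniform on {1,2,3,4}, and define (X,Y) = (2-ψ_{1/2}(Z_P), 2-1/Z_P) if B=1; (2-ψ_{-1/2}(Z_P), 2-1/√Z_P) if B=2; (1-1/Z_P, 2-1/Z_P) if B=3; (2-1/Z_P, 1-1/Z_P) if B=4. Then P(Y ≤ y) = y/4 for 0 ≤ y ≤ 1 and P(Y ≤ y) = y/2 - (2-y)²/4 for 1 ≤ y ≤ 2. -/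
open MeasureTheory ProbabilityTheory Filter Set

/-- The reciprocal of a standard Pareto variable is uniform on the unit interval. -/
lemma pareto_measure_le_inv {Ω : Type*} [MeasurableSpace Ω] {μ : Measure Ω}
    [IsProbabilityMeasure μ] {Z : Ω → ℝ}
    (hZ : ∀ z : ℝ, μ {ω | Z ω ≤ z} = if z < 1 then 0 else ENNReal.ofReal (1 - 1 / z))
    (hZ1 : ∀ᵐ ω ∂μ, 1 < Z ω) {t : ℝ} (ht0 : 0 ≤ t) (ht1 : t ≤ 1) :
    μ {ω | t ≤ 1 / Z ω} = ENNReal.ofReal (1 - t) := by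
  rcases ht0.eq_or_lt with rfl | ht
  · have h : ∀ᵐ ω ∂μ, 0 ≤ 1 / Z ω := by
      filter_upwards [hZ1] with ω hω
      positivity
    rw [measure_congr (eventuallyEq_univ.2 h), measure_univ, sub_zero, ENNReal.ofReal_one]
  · have h : {ω | t ≤ 1 / Z ω} =ᵐ[μ] {ω | Z ω ≤ 1 / t} := by
      rw [eventuallyEq_set]
      filter_upwards [hZ1] with ω hω
      exact le_one_div ht (by linarith)
    rw [measure_congr h, hZ, if_neg (not_lt.2 (by rwa [le_div_iff₀ ht, one_mul])), one_div_one_div]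

/-- The mass of an event that on `{B = i}` coincides with `{t i ≤ 1 / Z}`, for `B` uniform on
`{1, 2, 3, 4}` and independent of the standard Pareto variable `Z`. -/
lemma pareto_mixture_measure {Ω : Type*} [MeasurableSpace Ω] {μ : Measure Ω}
    [IsProbabilityMeasure μ] {Z : Ω → ℝ} {B : Ω → ℕ} (hZm : Measurable Z) (hBm : Measurable B)
    (hZ : ∀ z : ℝ, μ {ω | Z ω ≤ z} = if z < 1 then 0 else ENNReal.ofReal (1 - 1 / z))
    (hZ1 : ∀ᵐ ω ∂μ, 1 < Z ω)
    (hBvals : ∀ ω, B ω = 1 ∨ B ω = 2 ∨ B ω = 3 ∨ B ω = 4)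
    (hBunif : ∀ i : ℕ, 1 ≤ i → i ≤ 4 → μ {ω | B ω = i} = 1/4)
    (hindep : IndepFun B Z μ) (t : ℕ → ℝ) (ht : ∀ i, 0 ≤ t i ∧ t i ≤ 1) {S : Set Ω}
    (hS : ∀ᵐ ω ∂μ, ω ∈ S ↔ t (B ω) ≤ 1 / Z ω) :
    μ S = ENNReal.ofReal ((4 - (t 1 + t 2 + t 3 + t 4)) / 4) := by
  have hmeas : ∀ i, MeasurableSet (B ⁻¹' {i} ∩ Z ⁻¹' {z | t i ≤ 1 / z}) := fun i ↦
    (hBm (measurableSet_singleton i)).inter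
      (hZm (measurableSet_le measurable_const (by fun_prop)))
  have hμ : ∀ i ∈ Finset.Icc 1 4,
      μ (B ⁻¹' {i} ∩ Z ⁻¹' {z | t i ≤ 1 / z}) = ENNReal.ofReal ((1 - t i) / 4) := by
    intro i hi
    rw [Finset.mem_Icc] at hi
    have hB : μ (B ⁻¹' {i}) = 1 / 4 := hBunif i hi.1 hi.2
    have hU : μ (Z ⁻¹' {z | t i ≤ 1 / z}) = ENNReal.ofReal (1 - t i) :=
      pareto_measure_le_inv hZ hZ1 (ht i).1 (ht i).2
    rw [hindep.measure_inter_preimage_eq_mul _ _ (measurableSet_singleton i)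
      (measurableSet_le measurable_const (by fun_prop)), hB, hU,
      ENNReal.ofReal_div_of_pos (by norm_num), one_div, mul_comm, ENNReal.div_eq_inv_mul, mul_comm]
    simp
  have hunion : S =ᵐ[μ] ⋃ i ∈ Finset.Icc 1 4, (B ⁻¹' {i} ∩ Z ⁻¹' {z | t i ≤ 1 / z}) := by
    rw [eventuallyEq_set]
    filter_upwards [hS] with ω hω
    rw [hω]
    have : 1 ≤ B ω ∧ B ω ≤ 4 := by have := hBvals ω; lia
    simp [this]
  have hdisj : (↑(Finset.Icc 1 4) : Set ℕ).PairwiseDisjoint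
      fun i ↦ B ⁻¹' {i} ∩ Z ⁻¹' {z | t i ≤ 1 / z} := fun i _ j _ hij ↦
    ((disjoint_singleton.2 hij).preimage B).mono inter_subset_left inter_subset_left
  rw [measure_congr hunion, measure_biUnion_finset hdisj fun i _ ↦ hmeas i,
    Finset.sum_congr rfl hμ,
    ← ENNReal.ofReal_sum_of_nonneg fun i _ ↦ by linarith [(ht i).2]]
  congr 1
  rw [show Finset.Icc 1 4 = {1, 2, 3, 4} from rfl]
  simp
  ring

theorem stmt15 {Ω : Type*} [MeasurableSpace Ω] (μ : Measure Ω) [IsProbabilityMeasure μ]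
    (Z : Ω → ℝ) (B : Ω → ℕ) (hZm : Measurable Z) (hBm : Measurable B)
    (hZ : ∀ z : ℝ, μ {ω | Z ω ≤ z} = if z < 1 then 0 else ENNReal.ofReal (1 - 1 / z))
    (hBvals : ∀ ω, B ω = 1 ∨ B ω = 2 ∨ B ω = 3 ∨ B ω = 4)
    (hBunif : ∀ i : ℕ, 1 ≤ i → i ≤ 4 → μ {ω | B ω = i} = 1/4)
    (hindep : IndepFun B Z μ)
    (ψhalf ψneg : ℝ → ℝ)
    (hψhalf : ∀ z : ℝ, 1 ≤ z →
      0 < ψhalf z ∧ ψhalf z ≤ 1 ∧ gc (1/2) (ψhalf z) = 1 / z)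
    (hψneg : ∀ z : ℝ, 1 ≤ z →
      0 < ψneg z ∧ ψneg z ≤ 1 ∧ gc (-(1/2)) (ψneg z) = 1 / z)
    (X Y : Ω → ℝ)
    (hXdef : ∀ ω, X ω =
      if B ω = 1 then 2 - ψhalf (Z ω)
      else if B ω = 2 then 2 - ψneg (Z ω)
      else if B ω = 3 then 1 - 1 / Z ω
      else 2 - 1 / Z ω)
    (hYdef : ∀ ω, Y ω =
      if B ω = 2 then 2 - 1 / Real.sqrt (Z ω)
      else if B ω = 4 then 1 - 1 / Z ω
      else 2 - 1 / Z ω) :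
    (∀ y : ℝ, 0 ≤ y → y ≤ 1 → μ {ω | Y ω ≤ y} = ENNReal.ofReal (y / 4)) ∧
    (∀ y : ℝ, 1 ≤ y → y ≤ 2 →
      μ {ω | Y ω ≤ y} = ENNReal.ofReal (y / 2 - (2 - y) ^ 2 / 4)) := by
  have hZ1 : ∀ᵐ ω ∂μ, 1 < Z ω := by
    have h : μ {ω | Z ω ≤ 1} = 0 := by simp [hZ]
    simpa [ae_iff] using h
  refine ⟨fun y hy0 hy1 ↦ ?_, fun y hy1 hy2 ↦ ?_⟩
  · rw [pareto_mixture_measure hZm hBm hZ hZ1 hBvals hBunif hindep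
      (fun i ↦ if i = 4 then 1 - y else 1) ?_ ?_]
    · congr 1
      norm_num
      ring
    · intro i
      split_ifs <;> constructor <;> linarith
    · filter_upwards [hZ1] with ω hω
      have hU : 1 / Z ω < 1 := by rwa [div_lt_one (by linarith)]
      have hV : 1 / √(Z ω) < 1 := by
        have h : 1 < √(Z ω) := by rwa [Real.lt_sqrt zero_le_one, one_pow]
        rwa [div_lt_one (by linarith)]
      rw [hYdef]
      rcases hBvals ω with h | h | h | h <;> simp only [h] <;> norm_num only [if_true, if_false] <;>
        constructor <;> intro h' <;> linarith
  · rw [pareto_mixture_measure hZm hBm hZ hZ1 hBvals hBunif hindep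
      (fun i ↦ if i = 4 then 0 else if i = 2 then (2 - y) ^ 2 else 2 - y) ?_ ?_]
    · congr 1
      norm_num
      ring
    · intro i
      split_ifs <;> constructor <;> nlinarith
    · filter_upwards [hZ1] with ω hω
      have hU : 1 / Z ω < 1 := by rwa [div_lt_one (by linarith)]
      have hU0 : 0 < 1 / Z ω := by positivity
      have hV : 2 - y ≤ 1 / √(Z ω) ↔ (2 - y) ^ 2 ≤ 1 / Z ω := by
        rw [one_div, ← Real.sqrt_inv, ← one_div, Real.le_sqrt (by linarith) hU0.le]
      rw [hYdef]
      rcases hBvals ω with h | h | h | h <;> simp only [h] <;> norm_num only [if_true, if_false]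
      · constructor <;> intro h' <;> linarith
      · rw [← hV]
        constructor <;> intro h' <;> linarith
      · constructor <;> intro h' <;> linarith
      · constructor <;> intro h' <;> linarith
end
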